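/- arXiv:2002.06404 — 2 statements merged into one kernel-verified Lean document; each statement's English description precedes it below -/
import Mathlib

section
/- Fix π ∈ {1,…,r} and scalars λ_i ∈ K (i ≠ π) and α_j ∈ K (1 ≤ j ≤ n), and let M ⊆ R^r be the submodule generated by the r+n−1 elements e_i + λ_i e_π (i ≠ π) and (X_j − α_j)e_π (1 ≤ j ≤ n). Then R^r/M has dimension 1 as a K-vector space, and this list of generators is a reduced ≤-Gröbner basis of M for every monomial order ≤ on R^r such that λ_i = 0 whenever e_i < e_π (for all i ≠ π). -/
open MvPolynomial

/-! ### Monomials of the free module `R^r`, monomial orders, Gröbner bases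

Here `R = K[X₁,…,Xₙ]` is `MvPolynomial (Fin n) K` and the free module `R^r`
is `Fin r → MvPolynomial (Fin n) K` (row vectors).  A monomial `ν eᵢ` of `R^r`
is encoded as a pair `(ν, i)`. -/

/-- A monomial of the free module `R^r`: an exponent vector in `n` variables
together with the index of the coordinate vector supporting it. -/
abbrev ModMon (n r : ℕ) := (Fin n →₀ ℕ) × Fin r

/-- Multiplication of a module monomial by a ring monomial. -/
noncomputable def smulMon {n r : ℕ} (ν : Fin n →₀ ℕ) (μ : ModMon n r) : ModMon n r :=
  (ν + μ.1, μ.2)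

/-- A monomial order on `R^r`: a total order on the monomials of `R^r` such that
`μ₁ ≤ μ₂` implies `μ₁ ≤ ν·μ₁ ≤ ν·μ₂` for every ring monomial `ν`. -/
structure ModMonomialOrder (n r : ℕ) where
  le : ModMon n r → ModMon n r → Prop
  le_refl : ∀ a, le a a
  le_trans : ∀ a b c, le a b → le b c → le a c
  le_antisymm : ∀ a b, le a b → le b a → a = b
  le_total : ∀ a b, le a b ∨ le b a
  compat : ∀ (ν : Fin n →₀ ℕ) (a b : ModMon n r),
    le a b → le a (smulMon ν a) ∧ le (smulMon ν a) (smulMon ν b)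

/-- The strict order associated with a monomial order. -/
def ModMonomialOrder.lt {n r : ℕ} (ord : ModMonomialOrder n r)
    (a b : ModMon n r) : Prop :=
  ord.le a b ∧ a ≠ b

/-- The module monomial `μ = ν eᵢ` as an element of `R^r`. -/
noncomputable def monElem (K : Type) [Field K] {n r : ℕ} (μ : ModMon n r) :
    Fin r → MvPolynomial (Fin n) K :=
  Pi.single μ.2 (monomial μ.1 (1 : K))

/-- `μ` is the `ord`-leading monomial of `p ∈ R^r`: it appears in `p` and every
monomial appearing in `p` is `≤ μ`. -/
def IsLM {K : Type} [Field K] {n r : ℕ} (ord : ModMonomialOrder n r)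
    (p : Fin r → MvPolynomial (Fin n) K) (μ : ModMon n r) : Prop :=
  coeff μ.1 (p μ.2) ≠ 0 ∧
  ∀ (m : Fin n →₀ ℕ) (i : Fin r), coeff m (p i) ≠ 0 → ord.le (m, i) μ

/-- Divisibility of module monomials: `μ ∣ μ'` iff `μ' = ν·μ` for a ring monomial `ν`. -/
def monDvd {n r : ℕ} (μ μ' : ModMon n r) : Prop :=
  ∃ ν : Fin n →₀ ℕ, smulMon ν μ = μ'

/-- The `ord`-leading module of a submodule `M ⊆ R^r`: the submodule generated by
the leading monomials of the nonzero elements of `M`. -/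
noncomputable def leadingSubmodule {K : Type} [Field K] {n r : ℕ}
    (ord : ModMonomialOrder n r)
    (M : Submodule (MvPolynomial (Fin n) K) (Fin r → MvPolynomial (Fin n) K)) :
    Submodule (MvPolynomial (Fin n) K) (Fin r → MvPolynomial (Fin n) K) :=
  Submodule.span (MvPolynomial (Fin n) K)
    {v | ∃ p ∈ M, ∃ μ : ModMon n r, IsLM ord p μ ∧ v = monElem K μ}

/-- `G` is a `ord`-Gröbner basis of `M`. -/
def IsGB {K : Type} [Field K] {n r : ℕ} {ι : Type} (ord : ModMonomialOrder n r)
    (M : Submodule (MvPolynomial (Fin n) K) (Fin r → MvPolynomial (Fin n) K))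
    (G : ι → Fin r → MvPolynomial (Fin n) K) : Prop :=
  (∀ i, G i ∈ M) ∧
  leadingSubmodule ord M =
    Submodule.span (MvPolynomial (Fin n) K)
      {v | ∃ (i : ι) (μ : ModMon n r), IsLM ord (G i) μ ∧ v = monElem K μ}

/-- `G` is a minimal `ord`-Gröbner basis of `M`: no leading monomial of an element
divides that of another element. -/
def IsMinimalGB {K : Type} [Field K] {n r : ℕ} {ι : Type} (ord : ModMonomialOrder n r)
    (M : Submodule (MvPolynomial (Fin n) K) (Fin r → MvPolynomial (Fin n) K))
    (G : ι → Fin r → MvPolynomial (Fin n) K) : Prop :=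
  IsGB ord M G ∧
  ∀ (i j : ι), i ≠ j → ∀ (μi μj : ModMon n r),
    IsLM ord (G i) μi → IsLM ord (G j) μj → ¬ monDvd μi μj

/-- `G` is the reduced `ord`-Gröbner basis of `M`: minimal, leading coefficients `1`,
and no term of `G i` is divisible by the leading monomial of `G j` for `j ≠ i`. -/
def IsReducedGB {K : Type} [Field K] {n r : ℕ} {ι : Type} (ord : ModMonomialOrder n r)
    (M : Submodule (MvPolynomial (Fin n) K) (Fin r → MvPolynomial (Fin n) K))
    (G : ι → Fin r → MvPolynomial (Fin n) K) : Prop :=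
  IsMinimalGB ord M G ∧
  (∀ (i : ι) (μi : ModMon n r), IsLM ord (G i) μi → coeff μi.1 (G i μi.2) = 1) ∧
  (∀ (i j : ι), i ≠ j → ∀ (μj : ModMon n r), IsLM ord (G j) μj →
    ∀ (m : Fin n →₀ ℕ) (l : Fin r), coeff m (G i l) ≠ 0 → ¬ monDvd μj (m, l))

/-- The rows of the elementary matrix `E ∈ R^{(k+n-1)×k}` with pivot `π`,
constants `lam i` (for `i ≠ π`) and `α j`: the rows `εᵢ + λᵢ ε_π` for `i ≠ π`
and `(Xⱼ - αⱼ) ε_π` for `1 ≤ j ≤ n`. -/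
noncomputable def elemRow {K : Type} [Field K] {n k : ℕ} (π : Fin k)
    (lam : Fin k → K) (α : Fin n → K) :
    ({i : Fin k // i ≠ π} ⊕ Fin n) → Fin k → MvPolynomial (Fin n) K :=
  Sum.elim
    (fun i => Pi.single i.1 (1 : MvPolynomial (Fin n) K)
      + lam i.1 • (Pi.single π 1 : Fin k → MvPolynomial (Fin n) K))
    (fun j => (X j - C (α j)) • (Pi.single π 1 : Fin k → MvPolynomial (Fin n) K))

/-- Rows of the matrix product `E·G` where `E` has rows in `R^k` indexed by `ι`
and `G ∈ R^{k×r}`. -/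
noncomputable def rowMul {K : Type} [Field K] {n k r : ℕ} {ι : Type}
    (E : ι → Fin k → MvPolynomial (Fin n) K)
    (G : Fin k → Fin r → MvPolynomial (Fin n) K) :
    ι → Fin r → MvPolynomial (Fin n) K :=
  fun a c => ∑ b, E a b * G b c

/-- `sord` is a Schreyer order for `ord` and the list of monomials `LM`. -/
def IsSchreyerOrder {n r k : ℕ} (ord : ModMonomialOrder n r)
    (LM : Fin k → ModMon n r) (sord : ModMonomialOrder n k) : Prop :=
  ∀ (ν₁ ν₂ : Fin n →₀ ℕ) (i j : Fin k),
    ord.lt (smulMon ν₁ (LM i)) (smulMon ν₂ (LM j)) → sord.le (ν₁, i) (ν₂, j)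

/-- Row vector times matrix, as a linear map `R^r → R^s`. -/
noncomputable def vecMulLin {K : Type} [Field K] {n r s : ℕ}
    (F : Fin r → Fin s → MvPolynomial (Fin n) K) :
    (Fin r → MvPolynomial (Fin n) K) →ₗ[MvPolynomial (Fin n) K]
      (Fin s → MvPolynomial (Fin n) K) :=
  Matrix.vecMulLinear (Matrix.of F)

/-- The syzygy module `Syz_N(F) = {p ∈ R^r : pF ∈ N}`. -/
noncomputable def Syz {K : Type} [Field K] {n r s : ℕ}
    (N : Submodule (MvPolynomial (Fin n) K) (Fin s → MvPolynomial (Fin n) K))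
    (F : Fin r → Fin s → MvPolynomial (Fin n) K) :
    Submodule (MvPolynomial (Fin n) K) (Fin r → MvPolynomial (Fin n) K) :=
  Submodule.comap (vecMulLin F) N

/-- `keepIdx K μ π j` holds iff `Xⱼ·μ_π` does not belong to the submodule of `R^r`
generated by the monomials `μ i`, `i ≠ π`. -/
def keepIdx (K : Type) [Field K] {n r k : ℕ} (μ : Fin k → ModMon n r) (π : Fin k)
    (j : Fin n) : Prop :=
  monElem K (smulMon (Finsupp.single j 1) (μ π)) ∉
    Submodule.span (MvPolynomial (Fin n) K)
      {v | ∃ i : Fin k, i ≠ π ∧ v = monElem K (μ i)}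

/-- The rows of the submatrix of the elementary matrix with pivot `π` keeping,
among the rows `(Xⱼ - αⱼ) ε_π`, only those with `P j`. -/
noncomputable def prunedRow {K : Type} [Field K] {n k : ℕ} (π : Fin k)
    (lam : Fin k → K) (α : Fin n → K) (P : Fin n → Prop) :
    ({i : Fin k // i ≠ π} ⊕ {j : Fin n // P j}) → Fin k → MvPolynomial (Fin n) K :=
  Sum.elim
    (fun i => Pi.single i.1 (1 : MvPolynomial (Fin n) K)
      + lam i.1 • (Pi.single π 1 : Fin k → MvPolynomial (Fin n) K))
    (fun j => (X j.1 - C (α j.1)) • (Pi.single π 1 : Fin k → MvPolynomial (Fin n) K))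

namespace ModMonomialOrder

variable {n r : ℕ} (ord : ModMonomialOrder n r)

theorem coordinate_le (m : Fin n →₀ ℕ) (i : Fin r) : ord.le (0, i) (m, i) := by
  simpa [smulMon] using (ord.compat m (0, i) (0, i) (ord.le_refl _)).1

end ModMonomialOrder

theorem IsLM.unique {K : Type} [Field K] {n r : ℕ} {ord : ModMonomialOrder n r}
    {p : Fin r → MvPolynomial (Fin n) K} {μ μ' : ModMon n r}
    (h : IsLM ord p μ) (h' : IsLM ord p μ') : μ = μ' :=
  ord.le_antisymm _ _ (h'.2 _ _ h.1) (h.2 _ _ h'.1)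

theorem monElem_mem_of_monDvd {K : Type} [Field K] {n r : ℕ} {μ μ' : ModMon n r}
    {N : Submodule (MvPolynomial (Fin n) K) (Fin r → MvPolynomial (Fin n) K)}
    (h : monDvd μ μ') (hμ : monElem K μ ∈ N) : monElem K μ' ∈ N := by
  obtain ⟨ν, rfl⟩ := h
  have : monElem K (smulMon ν μ) = monomial ν (1 : K) • monElem K μ := by
    simp [monElem, smulMon, ← Pi.single_smul, monomial_mul]
  exact this ▸ N.smul_mem _ hμ

section ElementaryRows

variable {K : Type} [Field K] {n r : ℕ} (π : Fin r) (lam : Fin r → K) (α : Fin n → K)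

/-- The monomial that leads the row of index `a` of an elementary matrix. -/
noncomputable def elemLM (π : Fin r) : ({i : Fin r // i ≠ π} ⊕ Fin n) → ModMon n r :=
  Sum.elim (fun i => (0, i.1)) (fun j => (Finsupp.single j 1, π))

theorem elemRow_inl_pivot (i : {i : Fin r // i ≠ π}) :
    elemRow π lam α (Sum.inl i) π = C (lam i) := by
  simp [elemRow, i.2.symm, smul_eq_C_mul]

theorem elemRow_inl_self (i : {i : Fin r // i ≠ π}) :
    elemRow π lam α (Sum.inl i) i = 1 := by
  simp [elemRow, i.2]

theorem elemRow_inl_of_ne (i : {i : Fin r // i ≠ π}) {l : Fin r} (hi : l ≠ i) (hl : l ≠ π) :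
    elemRow π lam α (Sum.inl i) l = 0 := by
  simp [elemRow, hi, hl]

theorem elemRow_inr_pivot (j : Fin n) :
    elemRow π lam α (Sum.inr j) π = X j - C (α j) := by
  simp [elemRow]

theorem elemRow_inr_of_ne (j : Fin n) {l : Fin r} (hl : l ≠ π) :
    elemRow π lam α (Sum.inr j) l = 0 := by
  simp [elemRow, hl]

theorem eq_of_coeff_elemRow_inl_ne_zero {i : {i : Fin r // i ≠ π}} {m : Fin n →₀ ℕ} {l : Fin r}
    (h : coeff m (elemRow π lam α (Sum.inl i) l) ≠ 0) :
    m = 0 ∧ (l = i ∨ l = π ∧ lam i ≠ 0) := by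
  by_cases hi : l = i
  · subst hi
    rw [elemRow_inl_self, coeff_one] at h
    exact ⟨by_contra fun hm => h (if_neg (Ne.symm hm)), Or.inl rfl⟩
  by_cases hl : l = π
  · subst hl
    rw [elemRow_inl_pivot, coeff_C] at h
    split_ifs at h with hm
    · exact ⟨hm.symm, Or.inr ⟨rfl, h⟩⟩
    · exact absurd rfl h
  · simp [elemRow_inl_of_ne π lam α i hi hl] at h

theorem eq_of_coeff_elemRow_inr_ne_zero {j : Fin n} {m : Fin n →₀ ℕ} {l : Fin r}
    (h : coeff m (elemRow π lam α (Sum.inr j) l) ≠ 0) :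
    l = π ∧ (m = Finsupp.single j 1 ∨ m = 0) := by
  by_cases hl : l = π
  · subst hl
    rw [elemRow_inr_pivot, coeff_sub, coeff_X, coeff_C] at h
    refine ⟨rfl, ?_⟩
    by_contra! hm
    simp [Ne.symm hm.1, Ne.symm hm.2] at h
  · simp [elemRow_inr_of_ne π lam α j hl] at h

theorem coeff_elemLM_elemRow (a : {i : Fin r // i ≠ π} ⊕ Fin n) :
    coeff (elemLM π a).1 (elemRow π lam α a (elemLM π a).2) = 1 := by
  rcases a with i | j
  · simp [elemLM, elemRow_inl_self]
  · have hj : (0 : Fin n →₀ ℕ) ≠ Finsupp.single j 1 := by simp [eq_comm]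
    simp [elemLM, elemRow_inr_pivot, coeff_X, coeff_C, hj]

theorem isLM_elemRow {ord : ModMonomialOrder n r}
    (h : ∀ i : Fin r, i ≠ π → ord.lt (0, i) (0, π) → lam i = 0)
    (a : {i : Fin r // i ≠ π} ⊕ Fin n) :
    IsLM ord (elemRow π lam α a) (elemLM π a) := by
  refine ⟨by simp [coeff_elemLM_elemRow], fun m l hml => ?_⟩
  rcases a with i | j
  · obtain ⟨rfl, rfl | ⟨rfl, hlam⟩⟩ := eq_of_coeff_elemRow_inl_ne_zero π lam α hml
    · exact ord.le_refl _
    · refine (ord.le_total _ _).resolve_right fun hle => hlam (h i i.2 ⟨hle, fun he => ?_⟩)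
      exact i.2 (congrArg Prod.snd he)
  · obtain ⟨rfl, rfl | rfl⟩ := eq_of_coeff_elemRow_inr_ne_zero π lam α hml
    · exact ord.le_refl _
    · exact ord.coordinate_le _ _

theorem not_elemLM_dvd_of_coeff_elemRow_ne_zero {a b : {i : Fin r // i ≠ π} ⊕ Fin n}
    (hab : a ≠ b) {m : Fin n →₀ ℕ} {l : Fin r} (h : coeff m (elemRow π lam α a l) ≠ 0) :
    ¬ monDvd (elemLM π b) (m, l) := by
  rintro ⟨ν, hν⟩
  obtain ⟨h₁, h₂⟩ := Prod.ext_iff.1 hν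
  have single_ne (j : Fin n) : ν + Finsupp.single j 1 ≠ 0 := by simp
  rcases a with i | j
  · obtain ⟨rfl, hl⟩ := eq_of_coeff_elemRow_inl_ne_zero π lam α h
    rcases b with i' | j'
    · have hi' : (i' : Fin r) = l := h₂
      rcases hl with rfl | ⟨rfl, -⟩
      · exact hab (congrArg Sum.inl (Subtype.ext hi').symm)
      · exact i'.2 hi'
    · exact single_ne j' h₁
  · obtain ⟨rfl, hm⟩ := eq_of_coeff_elemRow_inr_ne_zero π lam α h
    rcases b with i' | j'
    · exact i'.2 h₂
    · rcases hm with rfl | rfl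
      · have h₃ : ν + Finsupp.single j' 1 = Finsupp.single j 1 := h₁
        have h₄ := DFunLike.congr_fun h₃ j'
        have hj : j ≠ j' := fun hj => hab (congrArg Sum.inr hj)
        simp [hj] at h₄
      · exact single_ne j' h₁

/-- The functional `p ↦ p_π(α) - ∑_{i ≠ π} λᵢ pᵢ(α)`, whose kernel is the module generated by
the rows of the elementary matrix. -/
noncomputable def elemFunctional : (Fin r → MvPolynomial (Fin n) K) →ₗ[K] K :=
  (aeval α).toLinearMap ∘ₗ LinearMap.proj π -
    ∑ i ∈ Finset.univ.erase π, lam i • ((aeval α).toLinearMap ∘ₗ LinearMap.proj i)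

theorem elemFunctional_apply (p : Fin r → MvPolynomial (Fin n) K) :
    elemFunctional π lam α p =
      eval α (p π) - ∑ i ∈ Finset.univ.erase π, lam i * eval α (p i) := by
  simp [elemFunctional, aeval_eq_eval]

theorem elemFunctional_smul (a : MvPolynomial (Fin n) K)
    (p : Fin r → MvPolynomial (Fin n) K) :
    elemFunctional π lam α (a • p) = eval α a * elemFunctional π lam α p := by
  simp only [elemFunctional_apply, Pi.smul_apply, smul_eq_mul, map_mul, mul_sub, Finset.mul_sum]
  congr 1
  exact Finset.sum_congr rfl fun i _ => by ring

theorem elemFunctional_single_pivot (a : MvPolynomial (Fin n) K) :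
    elemFunctional π lam α (Pi.single π a) = eval α a := by
  rw [elemFunctional_apply, Finset.sum_eq_zero, Pi.single_eq_same, sub_zero]
  intro i hi
  simp [Finset.ne_of_mem_erase hi]

theorem elemFunctional_elemRow (a : {i : Fin r // i ≠ π} ⊕ Fin n) :
    elemFunctional π lam α (elemRow π lam α a) = 0 := by
  rw [elemFunctional_apply]
  rcases a with i | j
  · rw [Finset.sum_eq_single_of_mem i.1 (by simp [i.2]), elemRow_inl_pivot, elemRow_inl_self]
    · simp
    · intro l hl hli
      simp [elemRow_inl_of_ne π lam α i hli (Finset.ne_of_mem_erase hl)]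
  · rw [Finset.sum_eq_zero, elemRow_inr_pivot]
    · simp
    · intro l hl
      simp [elemRow_inr_of_ne π lam α j (Finset.ne_of_mem_erase hl)]

theorem elemFunctional_eq_zero_of_mem_span {p : Fin r → MvPolynomial (Fin n) K}
    (hp : p ∈ Submodule.span (MvPolynomial (Fin n) K) (Set.range (elemRow π lam α))) :
    elemFunctional π lam α p = 0 := by
  induction hp using Submodule.span_induction with
  | mem x hx =>
    obtain ⟨a, rfl⟩ := hx
    exact elemFunctional_elemRow π lam α a
  | zero => exact map_zero _
  | add x y _ _ hx hy => rw [map_add, hx, hy, add_zero]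
  | smul a x _ hx => rw [elemFunctional_smul, hx, mul_zero]

theorem single_pivot_sub_C_eval_mem_span (q : MvPolynomial (Fin n) K) :
    (Pi.single π (q - C (eval α q)) : Fin r → MvPolynomial (Fin n) K) ∈
      Submodule.span (MvPolynomial (Fin n) K) (Set.range (elemRow π lam α)) := by
  induction q using MvPolynomial.induction_on with
  | C a => simp
  | add p q hp hq =>
    have := add_mem hp hq
    rw [← Pi.single_add] at this
    rwa [sub_add_sub_comm, ← map_add, ← map_add] at this
  | mul_X p j hp =>
    have hj := Submodule.smul_mem _ p
      (Submodule.subset_span (Set.mem_range_self (f := elemRow π lam α) (Sum.inr j)))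
    have := add_mem hj (Submodule.smul_mem _ (C (α j)) hp)
    convert this using 1
    simp only [elemRow, Sum.elim_inr, ← Pi.single_smul, ← Pi.single_add, smul_eq_mul, map_mul,
      eval_X, mul_one]
    congr 1
    ring

theorem single_add_single_pivot_mem_span {i : Fin r} (hi : i ≠ π) (q : MvPolynomial (Fin n) K) :
    (Pi.single i q + Pi.single π (C (lam i) * q) : Fin r → MvPolynomial (Fin n) K) ∈
      Submodule.span (MvPolynomial (Fin n) K) (Set.range (elemRow π lam α)) := by
  have := Submodule.smul_mem _ q
    (Submodule.subset_span (Set.mem_range_self (f := elemRow π lam α) (Sum.inl ⟨i, hi⟩)))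
  convert this using 1
  simp [elemRow, smul_add, ← Pi.single_smul, smul_eq_C_mul, mul_comm]

theorem sub_single_pivot_elemFunctional_mem_span (p : Fin r → MvPolynomial (Fin n) K) :
    p - Pi.single π (C (elemFunctional π lam α p)) ∈
      Submodule.span (MvPolynomial (Fin n) K) (Set.range (elemRow π lam α)) := by
  set N := Submodule.span (MvPolynomial (Fin n) K) (Set.range (elemRow π lam α))
  have single_mem (i : Fin r) (q : MvPolynomial (Fin n) K) :
      Pi.single i q - Pi.single π (C (elemFunctional π lam α (Pi.single i q))) ∈ N := by
    by_cases hi : i = π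
    · subst hi
      rw [elemFunctional_single_pivot, ← Pi.single_sub]
      exact single_pivot_sub_C_eval_mem_span i lam α q
    · have hrow := single_add_single_pivot_mem_span π lam α hi q
      have hf := elemFunctional_eq_zero_of_mem_span π lam α hrow
      rw [map_add, elemFunctional_single_pivot] at hf
      have := sub_mem hrow (single_pivot_sub_C_eval_mem_span π lam α (C (lam i) * q))
      convert this using 1
      rw [eq_neg_of_add_eq_zero_left hf, Pi.single_sub, map_neg, Pi.single_neg]
      abel
  have := Submodule.sum_mem N fun i (_ : i ∈ Finset.univ) => single_mem i (p i)
  rw [Finset.sum_sub_distrib, Finset.univ_sum_single] at this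
  convert this using 2
  conv_lhs => rw [← Finset.univ_sum_single p]
  rw [map_sum, map_sum]
  exact map_sum (AddMonoidHom.single (fun _ : Fin r => MvPolynomial (Fin n) K) π) _ _

theorem ker_elemFunctional :
    LinearMap.ker (elemFunctional π lam α) =
      (Submodule.span (MvPolynomial (Fin n) K)
        (Set.range (elemRow π lam α))).restrictScalars K := by
  ext p
  rw [LinearMap.mem_ker, Submodule.restrictScalars_mem]
  refine ⟨fun hp => ?_, elemFunctional_eq_zero_of_mem_span π lam α⟩
  simpa [hp] using sub_single_pivot_elemFunctional_mem_span π lam α p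

theorem finrank_quotient_span_elemRow :
    Module.finrank K ((Fin r → MvPolynomial (Fin n) K) ⧸
      (Submodule.span (MvPolynomial (Fin n) K)
        (Set.range (elemRow π lam α))).restrictScalars K) = 1 := by
  rw [← ker_elemFunctional]
  have hsurj : Function.Surjective (elemFunctional (n := n) π lam α) := fun c =>
    ⟨Pi.single π (C c), by rw [elemFunctional_single_pivot, eval_C]⟩
  rw [(LinearMap.quotKerEquivOfSurjective _ hsurj).finrank_eq, Module.finrank_self]

theorem not_isLM_pivot {ord : ModMonomialOrder n r}
    (h : ∀ i : Fin r, i ≠ π → ord.lt (0, i) (0, π) → lam i = 0)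
    {p : Fin r → MvPolynomial (Fin n) K}
    (hp : p ∈ Submodule.span (MvPolynomial (Fin n) K) (Set.range (elemRow π lam α))) :
    ¬ IsLM ord p (0, π) := by
  rintro ⟨hcoeff, hle⟩
  have hconst : p π = C (coeff 0 (p π)) := by
    ext m
    rw [coeff_C]
    split_ifs with hm
    · rw [← hm]
    · by_contra hm'
      have := ord.le_antisymm _ _ (ord.coordinate_le m π) (hle m π hm')
      exact hm (congrArg Prod.fst this)
  have hzero := elemFunctional_eq_zero_of_mem_span π lam α hp
  rw [elemFunctional_apply, Finset.sum_eq_zero, sub_zero, hconst, eval_C] at hzero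
  · exact hcoeff hzero
  · intro i hi
    have hiπ := Finset.ne_of_mem_erase hi
    by_cases hpi : p i = 0
    · simp [hpi]
    · obtain ⟨m, hm⟩ := exists_coeff_ne_zero hpi
      rw [h i hiπ ⟨ord.le_trans _ _ _ (ord.coordinate_le m i) (hle m i hm),
        fun he => hiπ (congrArg Prod.snd he)⟩, zero_mul]

theorem exists_elemLM_dvd {μ : ModMon n r} (hμ : μ ≠ (0, π)) :
    ∃ a, monDvd (elemLM π a) μ := by
  obtain ⟨m, i⟩ := μ
  by_cases hi : i = π
  · subst hi
    have hm : m ≠ 0 := fun hm => hμ (hm ▸ rfl)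
    obtain ⟨j, hj⟩ := Finsupp.ne_iff.1 hm
    refine ⟨Sum.inr j, m - Finsupp.single j 1, Prod.ext ?_ rfl⟩
    exact tsub_add_cancel_of_le (Finsupp.single_le_iff.2 (Nat.one_le_iff_ne_zero.2 hj))
  · exact ⟨Sum.inl ⟨i, hi⟩, m, Prod.ext (add_zero m) rfl⟩

theorem isGB_elemRow {ord : ModMonomialOrder n r}
    (h : ∀ i : Fin r, i ≠ π → ord.lt (0, i) (0, π) → lam i = 0) :
    IsGB ord (Submodule.span (MvPolynomial (Fin n) K) (Set.range (elemRow π lam α)))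
      (elemRow π lam α) := by
  have hmem (a) := Submodule.subset_span (R := MvPolynomial (Fin n) K)
    (Set.mem_range_self (f := elemRow π lam α) a)
  refine ⟨hmem, le_antisymm (Submodule.span_le.2 ?_) (Submodule.span_mono ?_)⟩
  · rintro _ ⟨p, hp, μ, hμ, rfl⟩
    have hne : μ ≠ (0, π) := by
      rintro rfl
      exact not_isLM_pivot π lam α h hp hμ
    obtain ⟨a, ha⟩ := exists_elemLM_dvd π hne
    exact monElem_mem_of_monDvd ha
      (Submodule.subset_span ⟨a, _, isLM_elemRow π lam α h a, rfl⟩)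
  · rintro _ ⟨a, μ, hμ, rfl⟩
    exact ⟨_, hmem a, μ, hμ, rfl⟩

theorem isReducedGB_elemRow {ord : ModMonomialOrder n r}
    (h : ∀ i : Fin r, i ≠ π → ord.lt (0, i) (0, π) → lam i = 0) :
    IsReducedGB ord (Submodule.span (MvPolynomial (Fin n) K) (Set.range (elemRow π lam α)))
      (elemRow π lam α) := by
  have eq_elemLM {a μ} (hμ : IsLM ord (elemRow π lam α a) μ) : μ = elemLM π a :=
    hμ.unique (isLM_elemRow π lam α h a)
  refine ⟨⟨isGB_elemRow π lam α h, fun a b hab μ μ' hμ hμ' => ?_⟩, fun a μ hμ => ?_,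
    fun a b hab μ hμ m l hml => ?_⟩
  · rw [eq_elemLM hμ]
    exact not_elemLM_dvd_of_coeff_elemRow_ne_zero π lam α hab.symm hμ'.1
  · rw [eq_elemLM hμ]
    exact coeff_elemLM_elemRow π lam α a
  · rw [eq_elemLM hμ]
    exact not_elemLM_dvd_of_coeff_elemRow_ne_zero π lam α hab hml

end ElementaryRows

/-- Conversely, the module generated by the rows of an
elementary matrix has codimension `1` in `R^k`, and these rows form a reduced
`≤`-Gröbner basis for every monomial order `≤` such that `λᵢ = 0` whenever
`eᵢ < e_π`. -/
theorem statement2 {K : Type} [Field K] {n r : ℕ}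
    (π : Fin r) (lam : Fin r → K) (α : Fin n → K)
    (M : Submodule (MvPolynomial (Fin n) K) (Fin r → MvPolynomial (Fin n) K))
    (hM : M = Submodule.span (MvPolynomial (Fin n) K)
      (Set.range (elemRow π lam α))) :
    Module.finrank K
      ((Fin r → MvPolynomial (Fin n) K) ⧸ M.restrictScalars K) = 1 ∧
    ∀ ord : ModMonomialOrder n r,
      (∀ i : Fin r, i ≠ π →
        ord.lt ((0 : Fin n →₀ ℕ), i) ((0 : Fin n →₀ ℕ), π) → lam i = 0) →
      IsReducedGB ord M (elemRow π lam α) := by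
  subst hM
  exact ⟨finrank_quotient_span_elemRow π lam α, fun _ h => isReducedGB_elemRow π lam α h⟩
end

section
/- Let ≤ be a monomial order on R^r, let G = (p₁,…,p_k) ∈ R^{k×r} be a ≤-Gröbner basis with μ_i = lm_≤(p_i), let ≺ be a Schreyer order for ≤ and (μ₁,…,μ_k), and let E ∈ R^{(k+n−1)×k} be elementary with pivot π, constants λ_i and α_j, such that λ_i = 0 whenever ε_i ≺ ε_π strictly. If μ_i ≠ μ_π for all i ≠ π, then the following are equivalent: (1) ⟨EG⟩ ≠ ⟨G⟩ (the submodule of R^r generated by the rows of EG differs from that generated by the rows of G); (2) p_π ∉ ⟨EG⟩; (3) μ_π does not belong to the submodule generated by the leading monomials {lm_≤(q) : q ∈ ⟨EG⟩, q ≠ 0}. -/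
open MvPolynomial

namespace ModMonomialOrder

variable {n r : ℕ} (ord : ModMonomialOrder n r)

theorem le_smulMon (ν : Fin n →₀ ℕ) (a : ModMon n r) : ord.le a (smulMon ν a) :=
  (ord.compat ν a a (ord.le_refl a)).1

theorem lt_of_le_of_lt {a b c : ModMon n r} (hab : ord.le a b) (hbc : ord.lt b c) :
    ord.lt a c := by
  refine ⟨ord.le_trans _ _ _ hab hbc.1, ?_⟩
  rintro rfl
  exact hbc.2 (ord.le_antisymm _ _ hbc.1 hab)

theorem wellFounded_lt : WellFounded ord.lt := by
  have hwqo : WellQuasiOrdered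
      (fun a b : ModMon n r => a.1 ≤ b.1 ∧ a.2 = b.2) :=
    (wellQuasiOrdered_le (α := Fin n →₀ ℕ)).prod (Finite.wellQuasiOrdered (α := Fin r) (· = ·))
  have : IsTrans (ModMon n r) ord.lt :=
    ⟨fun _ _ _ hab hbc => ord.lt_of_le_of_lt hab.1 hbc⟩
  have : Std.Irrefl ord.lt := ⟨fun _ h => h.2 rfl⟩
  have : IsStrictOrder (ModMon n r) ord.lt := {}
  rw [RelEmbedding.wellFounded_iff_isEmpty]
  refine ⟨fun f => ?_⟩
  obtain ⟨a, b, hab, hle, heq⟩ := hwqo f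
  have hlt : ord.lt (f b) (f a) := f.map_rel_iff.2 hab
  have hdvd : smulMon ((f b).1 - (f a).1) (f a) = f b :=
    Prod.ext (tsub_add_cancel_of_le hle) heq
  have hle' := ord.le_smulMon ((f b).1 - (f a).1) (f a)
  rw [hdvd] at hle'
  exact hlt.2 (ord.le_antisymm _ _ hlt.1 hle')

theorem exists_max (s : Finset (ModMon n r)) (hs : s.Nonempty) :
    ∃ a ∈ s, ∀ b ∈ s, ord.le b a := by
  induction hs using Finset.Nonempty.cons_induction with
  | singleton a => exact ⟨a, by simp, by simp [ord.le_refl]⟩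
  | cons a s ha hs ih =>
    obtain ⟨c, hc, hmax⟩ := ih
    rcases ord.le_total a c with h | h
    · exact ⟨c, by simp [hc], by simpa [h] using hmax⟩
    · refine ⟨a, by simp, ?_⟩
      simp only [Finset.mem_cons, forall_eq_or_imp]
      exact ⟨ord.le_refl a, fun b hb => ord.le_trans _ _ _ (hmax b hb) h⟩

end ModMonomialOrder

section LeadingMonomial

variable {K : Type} [Field K] {n r : ℕ} {ord : ModMonomialOrder n r}

theorem IsLM.eq {p : Fin r → MvPolynomial (Fin n) K} {μ μ' : ModMon n r}
    (h : IsLM ord p μ) (h' : IsLM ord p μ') : μ = μ' :=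
  ord.le_antisymm _ _ (h'.2 _ _ h.1) (h.2 _ _ h'.1)

theorem exists_isLM (ord : ModMonomialOrder n r) {p : Fin r → MvPolynomial (Fin n) K}
    (hp : p ≠ 0) : ∃ μ, IsLM ord p μ := by
  classical
  let s : Finset (ModMon n r) :=
    Finset.univ.biUnion fun i => (p i).support.image fun m => (m, i)
  have hmem (a : ModMon n r) : a ∈ s ↔ coeff a.1 (p a.2) ≠ 0 := by
    obtain ⟨m, i⟩ := a
    simp [s]
  have hs : s.Nonempty := by
    obtain ⟨i, hi⟩ := Function.ne_iff.1 hp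
    obtain ⟨m, hm⟩ := MvPolynomial.ne_zero_iff.1 hi
    exact ⟨(m, i), (hmem _).2 hm⟩
  obtain ⟨a, ha, hmax⟩ := ord.exists_max s hs
  exact ⟨a, (hmem a).1 ha, fun m i h => hmax (m, i) ((hmem _).2 h)⟩

theorem exists_monDvd_of_monElem_mem_span {S : Set (ModMon n r)} {μ : ModMon n r}
    (h : monElem K μ ∈ Submodule.span (MvPolynomial (Fin n) K) (monElem K '' S)) :
    ∃ s ∈ S, monDvd s μ := by
  classical
  have key : ∀ v ∈ Submodule.span (MvPolynomial (Fin n) K) (monElem K '' S),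
      ∀ (m : Fin n →₀ ℕ) (i : Fin r), coeff m (v i) ≠ 0 → ∃ s ∈ S, monDvd s (m, i) := by
    intro v hv
    induction hv using Submodule.span_induction with
    | mem v hv =>
      obtain ⟨s, hs, rfl⟩ := hv
      intro m i hmi
      refine ⟨s, hs, 0, ?_⟩
      by_cases hi : i = s.2
      · subst hi
        have hm : s.1 = m := by
          by_contra hne
          simp [monElem, coeff_monomial, hne] at hmi
        simp [smulMon, hm]
      · simp [monElem, hi] at hmi
    | zero => simp
    | add v w _ _ hv hw =>
      intro m i hmi
      by_cases h0 : coeff m (v i) = 0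
      · exact hw m i (by simpa [h0] using hmi)
      · exact hv m i h0
    | smul a v _ hv =>
      intro m i hmi
      rw [Pi.smul_apply, smul_eq_mul, coeff_mul] at hmi
      obtain ⟨x, hx, hne⟩ := Finset.exists_ne_zero_of_sum_ne_zero hmi
      obtain ⟨s, hs, ν, hν⟩ := hv x.2 i (right_ne_zero_of_mul hne)
      refine ⟨s, hs, x.1 + ν, ?_⟩
      have h1 := congrArg Prod.fst hν
      have h2 := congrArg Prod.snd hν
      simp only [smulMon] at h1 h2
      exact Prod.ext (by simp [smulMon, add_assoc, h1, Finset.HasAntidiagonal.mem_antidiagonal.1 hx]) h2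
  exact key _ h μ.1 μ.2 (by simp [monElem])

theorem exists_reduction {p g : Fin r → MvPolynomial (Fin n) K} {ν : Fin n →₀ ℕ}
    {μ : ModMon n r} (hp : IsLM ord p (smulMon ν μ)) (hg : IsLM ord g μ) :
    ∃ c : K, ∀ (m : Fin n →₀ ℕ) (i : Fin r),
      coeff m ((p - monomial ν c • g) i) ≠ 0 → ord.lt (m, i) (smulMon ν μ) := by
  refine ⟨coeff (ν + μ.1) (p μ.2) / coeff μ.1 (g μ.2), fun m i hmi => ⟨?_, ?_⟩⟩
  · by_cases h0 : coeff m (p i) = 0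
    · rw [Pi.sub_apply, Pi.smul_apply, smul_eq_mul, coeff_sub, h0, zero_sub, neg_ne_zero,
        coeff_monomial_mul'] at hmi
      split_ifs at hmi with hle
      · have hord := (ord.compat ν _ _ (hg.2 _ _ (right_ne_zero_of_mul hmi))).2
        rwa [smulMon, add_tsub_cancel_of_le hle] at hord
      · exact absurd rfl hmi
    · exact hp.2 m i h0
  · intro heq
    obtain ⟨rfl, rfl⟩ := Prod.ext_iff.1 heq
    apply hmi
    simp [smulMon, coeff_monomial_mul, div_mul_cancel₀ _ hg.1]

theorem mem_of_isLM_lt {ι : Type} {M N : Submodule (MvPolynomial (Fin n) K)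
      (Fin r → MvPolynomial (Fin n) K)} {G : ι → Fin r → MvPolynomial (Fin n) K}
    (hGB : IsGB ord M G) {b : ModMon n r}
    (hN : ∀ i μ, IsLM ord (G i) μ → ord.lt μ b → G i ∈ N)
    {p : Fin r → MvPolynomial (Fin n) K} (hp : p ∈ M) {μ : ModMon n r}
    (hμ : IsLM ord p μ) (hb : ord.lt μ b) : p ∈ N := by
  induction μ using ord.wellFounded_lt.induction generalizing p with
  | _ μ ih =>
    have hmem : monElem K μ ∈ leadingSubmodule ord M :=
      Submodule.subset_span ⟨p, hp, μ, hμ, rfl⟩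
    rw [hGB.2] at hmem
    have hset : {v | ∃ (i : ι) (μ : ModMon n r), IsLM ord (G i) μ ∧ v = monElem K μ} =
        monElem K '' {μ | ∃ i, IsLM ord (G i) μ} := by
      ext v
      constructor
      · rintro ⟨i, μ, h, rfl⟩
        exact ⟨μ, ⟨i, h⟩, rfl⟩
      · rintro ⟨μ, ⟨i, h⟩, rfl⟩
        exact ⟨i, μ, h, rfl⟩
    rw [hset] at hmem
    obtain ⟨μ', ⟨i, hi⟩, ν, rfl⟩ := exists_monDvd_of_monElem_mem_span hmem
    have hGN := hN i μ' hi (ord.lt_of_le_of_lt (ord.le_smulMon ν μ') hb)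
    obtain ⟨c, hc⟩ := exists_reduction hμ hi
    rw [← sub_add_cancel p (monomial ν c • G i)]
    refine N.add_mem ?_ (N.smul_mem _ hGN)
    by_cases h0 : p - monomial ν c • G i = 0
    · rw [h0]
      exact N.zero_mem
    · obtain ⟨μ₁, hμ₁⟩ := exists_isLM ord h0
      have hlt := hc _ _ hμ₁.1
      exact ih μ₁ hlt (M.sub_mem hp (M.smul_mem _ (hGB.1 i))) hμ₁ (ord.lt_of_le_of_lt hlt.1 hb)

end LeadingMonomial

section ElementaryRows

variable {K : Type} [Field K] {n k r : ℕ}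

theorem rowMul_mem_span {ι : Type} (E : ι → Fin k → MvPolynomial (Fin n) K)
    (G : Fin k → Fin r → MvPolynomial (Fin n) K) (a : ι) :
    rowMul E G a ∈ Submodule.span (MvPolynomial (Fin n) K) (Set.range G) := by
  have h : rowMul E G a = ∑ b, E a b • G b := by
    ext1 c
    simp [rowMul]
  rw [h]
  exact Submodule.sum_mem _ fun b _ => Submodule.smul_mem _ _ (Submodule.subset_span ⟨b, rfl⟩)

theorem rowMul_elemRow_inl (π : Fin k) (lam : Fin k → K) (α : Fin n → K)
    (G : Fin k → Fin r → MvPolynomial (Fin n) K) (i : {i : Fin k // i ≠ π}) :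
    rowMul (elemRow π lam α) G (Sum.inl i) =
      G i + (C (lam i) : MvPolynomial (Fin n) K) • G π := by
  ext1 c
  simp [rowMul, elemRow, add_mul, Finset.sum_add_distrib, Pi.single_apply, smul_eq_C_mul]

end ElementaryRows

/-- If `μᵢ ≠ μ_π` for all `i ≠ π`, then the following are
equivalent: `⟨EG⟩ ≠ ⟨G⟩`; `p_π ∉ ⟨EG⟩`; and `μ_π` does not belong to the
leading module of `⟨EG⟩`. -/
theorem statement6 {K : Type} [Field K] {n r k : ℕ}
    (ord : ModMonomialOrder n r)
    (G : Fin k → Fin r → MvPolynomial (Fin n) K)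
    (hGB : IsGB ord
      (Submodule.span (MvPolynomial (Fin n) K) (Set.range G)) G)
    (μ : Fin k → ModMon n r) (hμ : ∀ i, IsLM ord (G i) (μ i))
    (sord : ModMonomialOrder n k) (hs : IsSchreyerOrder ord μ sord)
    (π : Fin k) (lam : Fin k → K) (α : Fin n → K)
    (hlam : ∀ i : Fin k, i ≠ π →
      sord.lt ((0 : Fin n →₀ ℕ), i) ((0 : Fin n →₀ ℕ), π) → lam i = 0)
    (hdist : ∀ i : Fin k, i ≠ π → μ i ≠ μ π) :
    (Submodule.span (MvPolynomial (Fin n) K)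
        (Set.range (rowMul (elemRow π lam α) G)) ≠
      Submodule.span (MvPolynomial (Fin n) K) (Set.range G) ↔
     G π ∉ Submodule.span (MvPolynomial (Fin n) K)
        (Set.range (rowMul (elemRow π lam α) G))) ∧
    (G π ∉ Submodule.span (MvPolynomial (Fin n) K)
        (Set.range (rowMul (elemRow π lam α) G)) ↔
     monElem K (μ π) ∉ leadingSubmodule ord
        (Submodule.span (MvPolynomial (Fin n) K)
          (Set.range (rowMul (elemRow π lam α) G)))) := by
  classical
  set N := Submodule.span (MvPolynomial (Fin n) K)
    (Set.range (rowMul (elemRow π lam α) G)) with hNdef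
  set M := Submodule.span (MvPolynomial (Fin n) K) (Set.range G) with hMdef
  have hNM : N ≤ M := by
    rw [hNdef, Submodule.span_le]
    rintro _ ⟨a, rfl⟩
    exact rowMul_mem_span _ _ _
  have hrow : ∀ i, i ≠ π → G i + (C (lam i) : MvPolynomial (Fin n) K) • G π ∈ N := by
    intro i hi
    rw [← rowMul_elemRow_inl π lam α G ⟨i, hi⟩]
    exact Submodule.subset_span ⟨_, rfl⟩
  constructor
  · refine not_congr ⟨fun h => h ▸ Submodule.subset_span ⟨π, rfl⟩, fun h => ?_⟩
    refine le_antisymm hNM ?_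
    rw [hMdef, Submodule.span_le]
    rintro _ ⟨i, rfl⟩
    by_cases hi : i = π
    · exact hi ▸ h
    · exact (N.add_mem_iff_left (N.smul_mem _ h)).1 (hrow i hi)
  · refine not_congr ⟨fun h => Submodule.subset_span ⟨G π, h, μ π, hμ π, rfl⟩, fun h => ?_⟩
    have hset : {v | ∃ p ∈ N, ∃ μ : ModMon n r, IsLM ord p μ ∧ v = monElem K μ} =
        monElem K '' {μ | ∃ p ∈ N, IsLM ord p μ} := by
      ext v
      constructor
      · rintro ⟨p, hp, μ, h, rfl⟩
        exact ⟨μ, ⟨p, hp, h⟩, rfl⟩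
      · rintro ⟨μ, ⟨p, hp, h⟩, rfl⟩
        exact ⟨p, hp, μ, h, rfl⟩
    rw [leadingSubmodule, hset] at h
    obtain ⟨μ', ⟨p, hp, hpμ⟩, ν, hν⟩ := exists_monDvd_of_monElem_mem_span h
    have hsmall : ∀ i μ', IsLM ord (G i) μ' → ord.lt μ' (μ π) → G i ∈ N := by
      intro i μ' hi hlt
      obtain rfl := (hμ i).eq hi
      have hiπ : i ≠ π := by
        rintro rfl
        exact hlt.2 rfl
      have hlam0 : lam i = 0 := by
        refine hlam i hiπ ⟨hs 0 0 i π (by simpa [smulMon] using hlt), ?_⟩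
        simpa using hiπ
      simpa [hlam0] using hrow i hiπ
    have hπ := hμ π
    rw [← hν] at hπ
    obtain ⟨c, hc⟩ := exists_reduction hπ hpμ
    rw [hν] at hc
    rw [← sub_add_cancel (G π) (monomial ν c • p)]
    refine N.add_mem ?_ (N.smul_mem _ hp)
    by_cases h0 : G π - monomial ν c • p = 0
    · rw [h0]
      exact N.zero_mem
    · obtain ⟨μ₁, hμ₁⟩ := exists_isLM ord h0
      exact mem_of_isLM_lt hGB hsmall
        (M.sub_mem (Submodule.subset_span ⟨π, rfl⟩) (M.smul_mem _ (hNM hp))) hμ₁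
        (hc _ _ hμ₁.1)
end
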